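/- arXiv:1412.8252 — 2 statements merged into one kernel-verified Lean document; each statement's English description precedes it below -/
import Mathlib

section
/- (Moments of a discrete singular eigenfunction.) Let w be a real number with |w| > 1 and Λ^m(w) = 0, and set φ^m(w,μ) = (ϖ w / 2) g^m(w,μ)/(w−μ). Then for every integer l ≥ m, ∫_{−1}^{1} φ^m(w,μ) p_l^m(μ) (1−μ²)^m dμ = g_l^m(w). -/
open MeasureTheory Filter

/-- Legendre polynomial via Rodrigues' formula. -/
noncomputable def legendreP (l : ℕ) (x : ℝ) : ℝ :=
  (1 / (2 ^ l * (Nat.factorial l : ℝ))) *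
    iteratedDeriv l (fun y : ℝ => (y ^ 2 - 1) ^ l) x

/-- `p_l^m(μ) = √((l−m)!/(l+m)!) (d/dμ)^m P_l(μ)`; it vanishes for `l < m`
(in particular the convention `p_{m−1}^m = 0` holds). -/
noncomputable def pml (m l : ℕ) (μ : ℝ) : ℝ :=
  Real.sqrt ((Nat.factorial (l - m) : ℝ) / (Nat.factorial (l + m) : ℝ)) *
    iteratedDeriv m (legendreP l) μ

/-- `q_l^m(w) = (1/2) ∫_{−1}^{1} p_l^m(μ)/(w−μ) (1−μ²)^m dμ`. -/
noncomputable def qml (m l : ℕ) (w : ℝ) : ℝ :=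
  (1 / 2) * ∫ μ in (-1 : ℝ)..1, pml m l μ / (w - μ) * (1 - μ ^ 2) ^ m

/-- `h_l = 2l+1 − ϖ β_l` for `l ≤ L`, and `h_l = 2l+1` for `l > L`. -/
noncomputable def hcoef (ϖ : ℝ) (β : ℕ → ℝ) (L l : ℕ) : ℝ :=
  if l ≤ L then 2 * l + 1 - ϖ * β l else 2 * l + 1

/-- Auxiliary recursion: `chandraAux ϖ β L m ν n = g_{m+n}^m(ν)`, built from the
initial value `g_m^m(ν) = √((2m)!)/(2^m m!)`, the convention `g_{m−1}^m = 0`, and the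
three-term recurrence `ν h_l g_l^m = √((l+1)²−m²) g_{l+1}^m + √(l²−m²) g_{l−1}^m`. -/
noncomputable def chandraAux (ϖ : ℝ) (β : ℕ → ℝ) (L m : ℕ) (ν : ℝ) : ℕ → ℝ
  | 0 => Real.sqrt (Nat.factorial (2 * m)) / (2 ^ m * Nat.factorial m)
  | 1 => ν * hcoef ϖ β L m *
      (Real.sqrt (Nat.factorial (2 * m)) / (2 ^ m * Nat.factorial m)) /
      Real.sqrt (((m : ℝ) + 1) ^ 2 - (m : ℝ) ^ 2)
  | n + 2 =>
      (ν * hcoef ϖ β L (m + n + 1) * chandraAux ϖ β L m ν (n + 1) -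
          Real.sqrt (((m + n + 1 : ℕ) : ℝ) ^ 2 - (m : ℝ) ^ 2) * chandraAux ϖ β L m ν n) /
        Real.sqrt (((m + n + 2 : ℕ) : ℝ) ^ 2 - (m : ℝ) ^ 2)

/-- The normalized Chandrasekhar polynomial `g_l^m(ν)` (with value `0` for `l < m`). -/
noncomputable def gml (ϖ : ℝ) (β : ℕ → ℝ) (L m l : ℕ) (ν : ℝ) : ℝ :=
  if l < m then 0 else chandraAux ϖ β L m ν (l - m)

/-- `g^m(ν,μ) = Σ_{l=m}^{L} β_l p_l^m(μ) g_l^m(ν)`. -/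
noncomputable def gfun (ϖ : ℝ) (β : ℕ → ℝ) (L m : ℕ) (ν μ : ℝ) : ℝ :=
  ∑ l ∈ Finset.Icc m L, β l * pml m l μ * gml ϖ β L m l ν

/-- `Λ^m(w) = 1 − (ϖ w/2) ∫_{−1}^{1} g^m(w,μ)/(w−μ) (1−μ²)^m dμ`. -/
noncomputable def Lam (ϖ : ℝ) (β : ℕ → ℝ) (L m : ℕ) (w : ℝ) : ℝ :=
  1 - ϖ * w / 2 * ∫ μ in (-1 : ℝ)..1, gfun ϖ β L m w μ / (w - μ) * (1 - μ ^ 2) ^ m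

/-- The off-diagonal entry `b_l = √((l²−m²)/(h_l h_{l−1}))`. -/
noncomputable def bcoef (ϖ : ℝ) (β : ℕ → ℝ) (L m l : ℕ) : ℝ :=
  Real.sqrt (((l : ℝ) ^ 2 - (m : ℝ) ^ 2) / (hcoef ϖ β L l * hcoef ϖ β L (l - 1)))

/-- The symmetric tridiagonal matrix `B(m)` with rows/columns indexed by
`l ∈ {m, …, l_B}` (here `l = m + i` for `i : Fin (l_B − m + 1)`), zero diagonal and
off-diagonal entries `B(m)_{l,l−1} = B(m)_{l−1,l} = b_l`. -/
noncomputable def Bmat (ϖ : ℝ) (β : ℕ → ℝ) (L m lB : ℕ) :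
    Matrix (Fin (lB - m + 1)) (Fin (lB - m + 1)) ℝ :=
  fun i j =>
    if (i : ℕ) + 1 = (j : ℕ) then bcoef ϖ β L m (m + j)
    else if (j : ℕ) + 1 = (i : ℕ) then bcoef ϖ β L m (m + i)
    else 0


open Polynomial in
/-- The polynomial `(X² − 1)^l / (2^l l!)`, whose `l`-th derivative is the Legendre polynomial. -/
noncomputable def rodriguesPoly (l : ℕ) : ℝ[X] :=
  C (1 / (2 ^ l * (Nat.factorial l : ℝ))) * (X ^ 2 - 1) ^ l

/-- The unnormalized associated polynomial `(d/dx)^m P_{m+n}`. -/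
noncomputable def assocLegendre (m n : ℕ) : Polynomial ℝ :=
  Polynomial.derivative^[m + n + m] (rodriguesPoly (m + n))

/-- The polynomial function `p_{m+n}^m`. -/
noncomputable def normAssocLegendre (m n : ℕ) : Polynomial ℝ :=
  Polynomial.C (Real.sqrt ((Nat.factorial n : ℝ) / (Nat.factorial (m + n + m) : ℝ))) *
    assocLegendre m n

/-- The off-diagonal recurrence coefficient `√((m+n)² − m²)`. -/
noncomputable def recCoef (m n : ℕ) : ℝ :=
  Real.sqrt (((m + n : ℕ) : ℝ) ^ 2 - (m : ℝ) ^ 2)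

namespace Polynomial

theorem iteratedDeriv_eval_fun (p : ℝ[X]) (n : ℕ) :
    iteratedDeriv n (fun x => p.eval x) = fun x => (derivative^[n] p).eval x := by
  induction n generalizing p with
  | zero => simp
  | succ n ih =>
    have h : deriv (fun x => p.eval x) = fun x => p.derivative.eval x := by
      ext x; exact p.deriv
    rw [iteratedDeriv_succ', h, ih, Function.iterate_succ_apply]

end Polynomial

section Rodrigues

open Polynomial

theorem legendreP_eq_eval (l : ℕ) :
    legendreP l = fun x => (derivative^[l] (rodriguesPoly l)).eval x := by
  ext x
  have h : (fun y : ℝ => (y ^ 2 - 1) ^ l) = fun y => (((X : ℝ[X]) ^ 2 - 1) ^ l).eval y := by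
    ext y; simp
  rw [legendreP, h, iteratedDeriv_eval_fun, rodriguesPoly, iterate_derivative_C_mul, eval_mul,
    eval_C]

theorem pml_add_eq_eval (m n : ℕ) (x : ℝ) :
    pml m (m + n) x = (normAssocLegendre m n).eval x := by
  rw [pml, legendreP_eq_eval, iteratedDeriv_eval_fun, ← Function.iterate_add_apply,
    normAssocLegendre, assocLegendre, eval_mul, eval_C, Nat.add_sub_cancel_left,
    Nat.add_comm m (m + n)]

theorem derivative_rodriguesPoly_succ (l : ℕ) :
    derivative (rodriguesPoly (l + 1)) = rodriguesPoly l * X := by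
  have h : (1 : ℝ) / (2 ^ l * (Nat.factorial l : ℝ))
      = 1 / (2 ^ (l + 1) * (Nat.factorial (l + 1) : ℝ)) * (2 * ((l : ℝ) + 1)) := by
    have := Nat.factorial_ne_zero l
    rw [Nat.factorial_succ]
    push_cast
    field_simp
    ring
  rw [rodriguesPoly, rodriguesPoly, h]
  simp only [derivative_mul, derivative_C, derivative_pow, derivative_sub, derivative_X,
    derivative_one, C_mul, C_add, C_1, map_ofNat, map_natCast]
  simp
  ring

theorem sq_sub_one_mul_rodriguesPoly (l : ℕ) :
    (X ^ 2 - 1) * rodriguesPoly l = C (2 * ((l : ℝ) + 1)) * rodriguesPoly (l + 1) := by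
  have h : (1 : ℝ) / (2 ^ l * (Nat.factorial l : ℝ))
      = 2 * ((l : ℝ) + 1) * (1 / (2 ^ (l + 1) * (Nat.factorial (l + 1) : ℝ))) := by
    have := Nat.factorial_ne_zero l
    rw [Nat.factorial_succ]
    push_cast
    field_simp
    ring
  rw [rodriguesPoly, rodriguesPoly, h, C_mul]
  ring

theorem derivative_derivative_rodriguesPoly (l : ℕ) :
    derivative (derivative (rodriguesPoly (l + 2)))
      = C (2 * (l : ℝ) + 3) * rodriguesPoly (l + 1) + rodriguesPoly l := by
  rw [derivative_rodriguesPoly_succ, derivative_mul, derivative_rodriguesPoly_succ, derivative_X]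
  have h := sq_sub_one_mul_rodriguesPoly l
  simp only [C_mul, C_add, C_1, map_ofNat, map_natCast] at h ⊢
  linear_combination h

/-- The differential equation satisfied by the derivatives of `(X² − 1)^l / (2^l l!)`. -/
theorem rodriguesPoly_ode (l n : ℕ) :
    (X ^ 2 - 1) * derivative^[n + 2] (rodriguesPoly l)
      + C (2 * ((n : ℝ) + 1 - l)) * X * derivative^[n + 1] (rodriguesPoly l)
      + C (((n : ℝ) + 1) * (n - 2 * l)) * derivative^[n] (rodriguesPoly l) = 0 := by
  induction n with
  | zero =>
    have h1 : (X ^ 2 - 1) * derivative (rodriguesPoly l) =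
        C (2 * (l : ℝ)) * X * rodriguesPoly l := by
      cases l with
      | zero => simp [rodriguesPoly]
      | succ l =>
        rw [derivative_rodriguesPoly_succ, ← mul_assoc, sq_sub_one_mul_rodriguesPoly]
        push_cast
        ring
    have h2 := congrArg derivative h1
    simp only [derivative_mul, derivative_sub, derivative_X_pow, derivative_one, derivative_X,
      derivative_ofNat, derivative_natCast, Function.iterate_succ_apply', Function.iterate_zero,
      id, C_mul, C_add, C_sub,
      C_1, map_ofNat, map_natCast] at h2 ⊢
    push_cast at h2 ⊢
    linear_combination h2
  | succ n ih =>
    have h2 := congrArg derivative ih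
    simp only [derivative_mul, derivative_sub, derivative_add, derivative_X_pow, derivative_one,
      derivative_X, derivative_zero, derivative_ofNat, derivative_natCast,
      ← Function.iterate_succ_apply' derivative,
      C_mul, C_add, C_sub, C_1, map_ofNat, map_natCast] at h2 ⊢
    push_cast at h2 ⊢
    simp only [Nat.succ_eq_add_one] at h2 ⊢
    linear_combination h2

theorem assocLegendre_zero (m : ℕ) :
    assocLegendre m 0 = C ((Nat.factorial (2 * m) : ℝ) / (2 ^ m * Nat.factorial m)) := by
  have key : ∀ m : ℕ, derivative^[2 * m] (rodriguesPoly m)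
      = C ((Nat.factorial (2 * m) : ℝ) / (2 ^ m * Nat.factorial m)) := by
    intro m
    induction m with
    | zero => simp [rodriguesPoly]
    | succ m ih =>
      have hD : derivative^[2 * (m + 1)] (rodriguesPoly (m + 1))
          = C (2 * (m : ℝ) + 1) * derivative^[2 * m] (rodriguesPoly m) := by
        cases m with
        | zero =>
          simp [rodriguesPoly]
          rw [one_add_one_eq_two, ← map_ofNat C, ← C_mul]
          norm_num
        | succ m =>
          rw [show 2 * (m + 1 + 1) = 2 * (m + 1) + 1 + 1 by ring, Function.iterate_succ_apply,
            Function.iterate_succ_apply, derivative_derivative_rodriguesPoly,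
            iterate_map_add, iterate_derivative_C_mul]
          have h0 : derivative^[2 * (m + 1)] (rodriguesPoly m) = 0 := by
            apply iterate_derivative_eq_zero
            have hq : (rodriguesPoly m).natDegree ≤ m * 2 := by
              rw [rodriguesPoly]
              refine (natDegree_C_mul_le _ _).trans (natDegree_pow_le_of_le m ?_)
              compute_degree
            omega
          rw [h0, add_zero]
          push_cast
          ring_nf
      rw [hD, ih, ← C_mul]
      congr 1
      have := Nat.factorial_ne_zero m
      rw [show 2 * (m + 1) = 2 * m + 1 + 1 by ring, Nat.factorial_succ, Nat.factorial_succ,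
        Nat.factorial_succ]
      push_cast
      field_simp
      ring
  rw [assocLegendre, ← key]
  congr 2
  omega

theorem X_mul_assocLegendre_zero (m : ℕ) :
    C (2 * (m : ℝ) + 1) * X * assocLegendre m 0 = assocLegendre m 1 := by
  cases m with
  | zero => simp [assocLegendre, derivative_rodriguesPoly_succ, mul_comm]
  | succ m =>
    have hR := assocLegendre_zero (m + 1)
    have hode := rodriguesPoly_ode (m + 1) (2 * m + 1)
    have hR' : derivative^[2 * m + 1 + 1] (rodriguesPoly (m + 1)) = assocLegendre (m + 1) 0 := by
      rw [assocLegendre, show m + 1 + 0 + (m + 1) = 2 * m + 1 + 1 by ring, Nat.add_zero]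
    have hX : assocLegendre (m + 1) 1 = assocLegendre (m + 1) 0 * X
        + C (2 * ((m : ℝ) + 1)) * derivative^[2 * m + 1] (rodriguesPoly (m + 1)) := by
      rw [assocLegendre, show m + 1 + 1 + (m + 1) = (2 * m + 1 + 1) + 1 by ring,
        Function.iterate_succ_apply, derivative_rodriguesPoly_succ, iterate_derivative_mul_X, hR',
        nsmul_eq_mul]
      simp only [C_mul, C_add, C_1, map_ofNat, map_natCast]
      push_cast
      ring
    rw [Function.iterate_succ_apply' derivative (2 * m + 1 + 1), hR', hR, derivative_C, ← hR]
      at hode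
    rw [hX]
    simp only [C_mul, C_add, C_sub, C_1, map_ofNat, map_natCast] at hode ⊢
    push_cast at hode ⊢
    linear_combination hode

theorem X_mul_assocLegendre_succ (m n : ℕ) :
    C (2 * ((m : ℝ) + n + 1) + 1) * X * assocLegendre m (n + 1)
      = C ((n : ℝ) + 2) * assocLegendre m (n + 2)
        + C (2 * (m : ℝ) + n + 1) * assocLegendre m n := by
  have h1 : assocLegendre m (n + 2) = X * assocLegendre m (n + 1)
      + C (2 * (m : ℝ) + n + 1) * derivative^[m + n + m] (rodriguesPoly (m + n + 1)) := by
    rw [assocLegendre, show m + (n + 2) + m = (m + n + 1 + m) + 1 by ring,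
      Function.iterate_succ_apply, show m + (n + 2) = m + n + 1 + 1 by ring,
      derivative_rodriguesPoly_succ, iterate_derivative_mul_X, assocLegendre,
      show m + n + 1 + m - 1 = m + n + m by omega, show m + (n + 1) = m + n + 1 by ring,
      nsmul_eq_mul]
    simp only [C_mul, C_add, C_1, map_ofNat, map_natCast]
    push_cast
    ring
  have h2 : assocLegendre m (n + 2)
      = C (2 * ((m : ℝ) + n) + 3) * derivative^[m + n + m] (rodriguesPoly (m + n + 1))
        + assocLegendre m n := by
    rw [assocLegendre, show m + (n + 2) + m = (m + n + m) + 1 + 1 by ring,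
      Function.iterate_succ_apply, Function.iterate_succ_apply,
      show m + (n + 2) = m + n + 2 by ring,
      derivative_derivative_rodriguesPoly, iterate_map_add, iterate_derivative_C_mul,
      assocLegendre]
    push_cast
    ring
  simp only [C_mul, C_add, C_1, map_ofNat, map_natCast] at h1 h2 ⊢
  linear_combination -(2 * ((m : ℝ[X]) + n) + 3) * h1 + (2 * (m : ℝ[X]) + n + 1) * h2

theorem assocLegendre_ode (m n : ℕ) :
    (X ^ 2 - 1) * derivative (derivative (assocLegendre m n))
      + C (2 * ((m : ℝ) + 1)) * X * derivative (assocLegendre m n)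
      = C ((2 * (m : ℝ) + n + 1) * n) * assocLegendre m n := by
  have h := rodriguesPoly_ode (m + n) (m + n + m)
  simp only [Function.iterate_succ_apply', C_mul, C_add, C_sub, C_1, map_ofNat, map_natCast] at h
  simp only [assocLegendre, C_mul, C_add, C_1, map_ofNat, map_natCast]
  push_cast at h ⊢
  linear_combination h

end Rodrigues

section Normalization

open Polynomial

theorem sub_sq_pos_of_succ (m n : ℕ) : (0 : ℝ) < ((m + (n + 1) : ℕ) : ℝ) ^ 2 - (m : ℝ) ^ 2 := by
  push_cast
  nlinarith [(Nat.cast_nonneg n : (0 : ℝ) ≤ n), (Nat.cast_nonneg m : (0 : ℝ) ≤ m)]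

theorem recCoef_succ_pos (m n : ℕ) : 0 < recCoef m (n + 1) :=
  Real.sqrt_pos.2 (sub_sq_pos_of_succ m n)

theorem recCoef_mul_sqrt_succ (m n : ℕ) :
    recCoef m (n + 1) * √((Nat.factorial (n + 1) : ℝ) / (Nat.factorial (m + (n + 1) + m) : ℝ))
      = ((n : ℝ) + 1) * √((Nat.factorial n : ℝ) / (Nat.factorial (m + n + m) : ℝ)) := by
  have h1 : ((n : ℝ) + 1) = √(((n : ℝ) + 1) ^ 2) := (Real.sqrt_sq (by positivity)).symm
  rw [recCoef, h1, ← Real.sqrt_mul (sub_sq_pos_of_succ m n).le, ← Real.sqrt_mul (by positivity)]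
  congr 1
  rw [show m + (n + 1) + m = m + n + m + 1 by ring, Nat.factorial_succ, Nat.factorial_succ]
  have := Nat.factorial_ne_zero (m + n + m)
  push_cast
  field_simp
  ring

theorem recCoef_mul_sqrt (m n : ℕ) :
    recCoef m (n + 1) * √((Nat.factorial n : ℝ) / (Nat.factorial (m + n + m) : ℝ))
      = (2 * (m : ℝ) + n + 1)
        * √((Nat.factorial (n + 1) : ℝ) / (Nat.factorial (m + (n + 1) + m) : ℝ)) := by
  have h1 : (2 * (m : ℝ) + n + 1) = √((2 * (m : ℝ) + n + 1) ^ 2) :=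
    (Real.sqrt_sq (by positivity)).symm
  rw [recCoef, h1, ← Real.sqrt_mul (sub_sq_pos_of_succ m n).le, ← Real.sqrt_mul (by positivity)]
  congr 1
  rw [show m + (n + 1) + m = m + n + m + 1 by ring, Nat.factorial_succ, Nat.factorial_succ]
  have := Nat.factorial_ne_zero (m + n + m)
  push_cast
  field_simp
  ring

theorem X_mul_normAssocLegendre_zero (m : ℕ) :
    C (2 * (m : ℝ) + 1) * X * normAssocLegendre m 0
      = C (recCoef m 1) * normAssocLegendre m 1 := by
  have h1 := congrArg C (recCoef_mul_sqrt_succ m 0)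
  have h2 := X_mul_assocLegendre_zero m
  simp only [zero_add, Nat.cast_zero, one_mul] at h1
  rw [C_mul] at h1
  rw [normAssocLegendre, normAssocLegendre]
  linear_combination (-assocLegendre m 1) * h1
    + C √((Nat.factorial 0 : ℝ) / (Nat.factorial (m + 0 + m) : ℝ)) * h2

theorem X_mul_normAssocLegendre_succ (m n : ℕ) :
    C (2 * ((m : ℝ) + n + 1) + 1) * X * normAssocLegendre m (n + 1)
      = C (recCoef m (n + 2)) * normAssocLegendre m (n + 2)
        + C (recCoef m (n + 1)) * normAssocLegendre m n := by
  have h1 := congrArg C (recCoef_mul_sqrt_succ m (n + 1))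
  have h3 := congrArg C (recCoef_mul_sqrt m n)
  have h2 := X_mul_assocLegendre_succ m n
  have h4 : C (((n + 1 : ℕ) : ℝ) + 1) = (C ((n : ℝ) + 2) : ℝ[X]) := by
    congr 1
    push_cast
    ring
  rw [C_mul, C_mul, h4] at h1
  rw [C_mul, C_mul] at h3
  simp only [normAssocLegendre]
  linear_combination (-assocLegendre m (n + 2)) * h1 - assocLegendre m n * h3
    + C √((Nat.factorial (n + 1) : ℝ) / (Nat.factorial (m + (n + 1) + m) : ℝ)) * h2

theorem normAssocLegendre_zero (m : ℕ) :
    normAssocLegendre m 0 = C (√(Nat.factorial (2 * m)) / (2 ^ m * Nat.factorial m)) := by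
  rw [normAssocLegendre, assocLegendre_zero, ← C_mul]
  congr 1
  have h : (0 : ℝ) < Nat.factorial (2 * m) := by positivity
  have h2 := Real.sq_sqrt h.le
  rw [Nat.factorial_zero, Nat.cast_one, Real.sqrt_div zero_le_one, Real.sqrt_one,
    show m + 0 + m = 2 * m by ring]
  field_simp
  exact h2.symm

end Normalization

section Moments

open Polynomial

/-- The linear functional `f ↦ ∫_{-1}^{1} f(x) ρ(x) dx` on polynomials. -/
noncomputable def momentFunctional (ρ : ℝ → ℝ) (hρ : ContinuousOn ρ (Set.uIcc (-1) 1)) :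
    ℝ[X] →ₗ[ℝ] ℝ where
  toFun f := ∫ x in (-1 : ℝ)..1, f.eval x * ρ x
  map_add' f g := by
    simp only [eval_add, add_mul]
    exact intervalIntegral.integral_add (f.continuousOn.mul hρ).intervalIntegrable
      (g.continuousOn.mul hρ).intervalIntegrable
  map_smul' c f := by
    simp only [eval_smul, smul_eq_mul, mul_assoc, RingHom.id_apply]
    exact intervalIntegral.integral_const_mul _ _

theorem momentFunctional_apply (ρ : ℝ → ℝ) (hρ : ContinuousOn ρ (Set.uIcc (-1) 1)) (f : ℝ[X]) :
    momentFunctional ρ hρ f = ∫ x in (-1 : ℝ)..1, f.eval x * ρ x := rfl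

/-- The functional `f ↦ ∫_{-1}^{1} f(x) (1 - x²)^m dx`. -/
noncomputable def weightFunctional (m : ℕ) : ℝ[X] →ₗ[ℝ] ℝ :=
  momentFunctional (fun x => (1 - x ^ 2) ^ m) (by fun_prop)

theorem weightFunctional_apply (m : ℕ) (f : ℝ[X]) :
    weightFunctional m f = ∫ x in (-1 : ℝ)..1, f.eval x * (1 - x ^ 2) ^ m := rfl

theorem map_C_mul_poly (Λ : ℝ[X] →ₗ[ℝ] ℝ) (c : ℝ) (f : ℝ[X]) : Λ (C c * f) = c * Λ f := by
  rw [← smul_eq_C_mul, map_smul, smul_eq_mul]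

/-- The integral of an exact derivative of a polynomial vanishing at `±1` is zero. -/
theorem weightFunctional_eq_zero (m : ℕ) (f q : ℝ[X])
    (h : derivative ((1 - X ^ 2) * q) = f * (1 - X ^ 2) ^ m) : weightFunctional m f = 0 := by
  have h1 : ∀ x : ℝ, f.eval x * (1 - x ^ 2) ^ m
      = (derivative ((1 - X ^ 2) * q)).eval x := by
    intro x
    simp [h]
  simp only [weightFunctional_apply, h1]
  rw [intervalIntegral.integral_eq_sub_of_hasDerivAt
    (fun x _ => ((1 - X ^ 2) * q).hasDerivAt x) ((Polynomial.continuous _).intervalIntegrable _ _)]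
  simp

theorem weightFunctional_normAssocLegendre_succ (m n : ℕ) :
    weightFunctional m (normAssocLegendre m (n + 1)) = 0 := by
  rw [normAssocLegendre, map_C_mul_poly]
  have h : weightFunctional m
      (C (-((2 * (m : ℝ) + (n + 1 : ℕ) + 1) * (n + 1 : ℕ))) * assocLegendre m (n + 1)) = 0 := by
    apply weightFunctional_eq_zero m _ ((1 - X ^ 2) ^ m * derivative (assocLegendre m (n + 1)))
    rw [← mul_assoc, ← pow_succ']
    have h := assocLegendre_ode m (n + 1)
    simp only [derivative_mul, derivative_pow, derivative_sub, derivative_one, derivative_X]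
    rw [C_neg]
    simp only [C_mul, C_add, C_1, map_ofNat, map_natCast] at h ⊢
    push_cast at h ⊢
    linear_combination (-(1 - X ^ 2 : ℝ[X]) ^ m) * h
  rw [map_C_mul_poly] at h
  have h0 : -((2 * (m : ℝ) + (n + 1 : ℕ) + 1) * (n + 1 : ℕ)) ≠ 0 := by
    apply neg_ne_zero.2
    positivity
  rw [(mul_eq_zero.1 h).resolve_left h0, mul_zero]

theorem weightFunctional_one (m : ℕ) :
    weightFunctional m 1 * Nat.factorial (2 * m + 1) = 2 * (2 ^ m * Nat.factorial m) ^ 2 := by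
  induction m with
  | zero =>
    simp [weightFunctional_apply]
    norm_num
  | succ m ih =>
    have h : weightFunctional m
        (C (2 * (m : ℝ) + 3) * (1 - X ^ 2) - C (2 * ((m : ℝ) + 1)) * 1) = 0 := by
      apply weightFunctional_eq_zero m _ ((1 - X ^ 2) ^ m * X)
      rw [← mul_assoc, ← pow_succ']
      simp only [derivative_mul, derivative_pow, derivative_sub, derivative_one, derivative_X]
      simp only [C_mul, C_add, C_1, map_ofNat, map_natCast]
      push_cast
      ring
    have h1 : weightFunctional m (1 - X ^ 2) = weightFunctional (m + 1) 1 := by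
      simp [weightFunctional_apply, pow_succ', -intervalIntegral.integral_mul_const]
    rw [map_sub, map_C_mul_poly, map_C_mul_poly, h1] at h
    rw [show 2 * (m + 1) + 1 = 2 * m + 1 + 1 + 1 by ring, Nat.factorial_succ (2 * m + 1 + 1),
      Nat.factorial_succ (2 * m + 1), Nat.factorial_succ m]
    push_cast
    linear_combination (2 * (m : ℝ) + 2) * (Nat.factorial (2 * m + 1) : ℝ) * h
      + (2 * (m : ℝ) + 2) ^ 2 * ih

theorem weightFunctional_mul_of_lt (m k n : ℕ) (hkn : k < n) :
    weightFunctional m (normAssocLegendre m k * normAssocLegendre m n) = 0 := by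
  induction k using Nat.strong_induction_on generalizing n with
  | _ k ih =>
    obtain ⟨n, rfl⟩ : ∃ j, n = j + 1 := ⟨n - 1, by omega⟩
    match k, ih, hkn with
    | 0, ih, hkn =>
      rw [normAssocLegendre_zero, map_C_mul_poly, weightFunctional_normAssocLegendre_succ, mul_zero]
    | k + 1, ih, hkn =>
      have hX : weightFunctional m
          (C (2 * ((m : ℝ) + n + 1) + 1) * (X * normAssocLegendre m k * normAssocLegendre m (n + 1)))
            = 0 := by
        have e : C (2 * ((m : ℝ) + n + 1) + 1)
              * (X * normAssocLegendre m k * normAssocLegendre m (n + 1))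
            = C (recCoef m (n + 2)) * (normAssocLegendre m k * normAssocLegendre m (n + 2))
              + C (recCoef m (n + 1)) * (normAssocLegendre m k * normAssocLegendre m n) := by
          linear_combination normAssocLegendre m k * X_mul_normAssocLegendre_succ m n
        rw [e, map_add, map_C_mul_poly, map_C_mul_poly, ih k (by omega) _ (by omega),
          ih k (by omega) _ (by omega)]
        ring
      have h0 : 2 * ((m : ℝ) + n + 1) + 1 ≠ 0 := by positivity
      rw [map_C_mul_poly] at hX
      have hX' := (mul_eq_zero.1 hX).resolve_left h0
      have h1 : weightFunctional m (C (recCoef m (k + 1))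
          * (normAssocLegendre m (k + 1) * normAssocLegendre m (n + 1))) = 0 := by
        cases k with
        | zero =>
          have e : C (recCoef m 1) * (normAssocLegendre m 1 * normAssocLegendre m (n + 1))
              = C (2 * (m : ℝ) + 1)
                * (X * normAssocLegendre m 0 * normAssocLegendre m (n + 1)) := by
            linear_combination (-normAssocLegendre m (n + 1)) * X_mul_normAssocLegendre_zero m
          rw [e, map_C_mul_poly, hX', mul_zero]
        | succ k =>
          have e : C (recCoef m (k + 2))
                * (normAssocLegendre m (k + 2) * normAssocLegendre m (n + 1))
              = C (2 * ((m : ℝ) + k + 1) + 1)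
                  * (X * normAssocLegendre m (k + 1) * normAssocLegendre m (n + 1))
                - C (recCoef m (k + 1))
                  * (normAssocLegendre m k * normAssocLegendre m (n + 1)) := by
            linear_combination (-normAssocLegendre m (n + 1)) * X_mul_normAssocLegendre_succ m k
          rw [e, map_sub, map_C_mul_poly, map_C_mul_poly, hX', ih k (by omega) _ (by omega)]
          ring
      rw [map_C_mul_poly] at h1
      exact (mul_eq_zero.1 h1).resolve_left (recCoef_succ_pos m k).ne'

theorem weightFunctional_mul_of_ne (m k n : ℕ) (hkn : k ≠ n) :
    weightFunctional m (normAssocLegendre m k * normAssocLegendre m n) = 0 := by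
  rcases lt_or_gt_of_ne hkn with h | h
  · exact weightFunctional_mul_of_lt m k n h
  · rw [mul_comm]
    exact weightFunctional_mul_of_lt m n k h

theorem weightFunctional_mul_self (m n : ℕ) :
    (2 * ((m : ℝ) + n) + 1)
      * weightFunctional m (normAssocLegendre m n * normAssocLegendre m n) = 2 := by
  induction n with
  | zero =>
    have h1 := weightFunctional_one m
    have hf : (0 : ℝ) < Nat.factorial (2 * m) := by positivity
    have h2 := Real.sq_sqrt hf.le
    rw [normAssocLegendre_zero, map_C_mul_poly, ← mul_one (C _), map_C_mul_poly]
    rw [Nat.factorial_succ] at h1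
    have hm : (Nat.factorial m : ℝ) ≠ 0 := by positivity
    push_cast at h1 ⊢
    field_simp
    rw [h2]
    linear_combination h1
  | succ n ih =>
    have hup : weightFunctional m (C (2 * ((m : ℝ) + n) + 1)
          * (X * normAssocLegendre m n * normAssocLegendre m (n + 1)))
        = recCoef m (n + 1)
          * weightFunctional m (normAssocLegendre m (n + 1) * normAssocLegendre m (n + 1)) := by
      cases n with
      | zero =>
        rw [← map_C_mul_poly]
        congr 1
        rw [Nat.cast_zero, add_zero]
        linear_combination normAssocLegendre m 1 * X_mul_normAssocLegendre_zero m
      | succ n =>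
        have e : C (2 * ((m : ℝ) + (n + 1 : ℕ)) + 1)
              * (X * normAssocLegendre m (n + 1) * normAssocLegendre m (n + 2))
            = C (recCoef m (n + 2)) * (normAssocLegendre m (n + 2) * normAssocLegendre m (n + 2))
              + C (recCoef m (n + 1)) * (normAssocLegendre m n * normAssocLegendre m (n + 2)) := by
          rw [show (m : ℝ) + (n + 1 : ℕ) = m + n + 1 by push_cast; ring]
          linear_combination normAssocLegendre m (n + 2) * X_mul_normAssocLegendre_succ m n
        rw [e, map_add, map_C_mul_poly, map_C_mul_poly,
          weightFunctional_mul_of_ne m n (n + 2) (by omega)]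
        ring
    have hdown : weightFunctional m (C (2 * ((m : ℝ) + n + 1) + 1)
          * (X * normAssocLegendre m n * normAssocLegendre m (n + 1)))
        = recCoef m (n + 1)
          * weightFunctional m (normAssocLegendre m n * normAssocLegendre m n) := by
      have e : C (2 * ((m : ℝ) + n + 1) + 1)
            * (X * normAssocLegendre m n * normAssocLegendre m (n + 1))
          = C (recCoef m (n + 2)) * (normAssocLegendre m n * normAssocLegendre m (n + 2))
            + C (recCoef m (n + 1)) * (normAssocLegendre m n * normAssocLegendre m n) := by
        linear_combination normAssocLegendre m n * X_mul_normAssocLegendre_succ m n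
      rw [e, map_add, map_C_mul_poly, map_C_mul_poly,
        weightFunctional_mul_of_ne m n (n + 2) (by omega)]
      ring
    rw [map_C_mul_poly] at hup hdown
    apply mul_left_cancel₀ (recCoef_succ_pos m n).ne'
    push_cast
    linear_combination (recCoef m (n + 1)) * ih - (2 * ((m : ℝ) + n + 1) + 1) * hup
      + (2 * ((m : ℝ) + n) + 1) * hdown

end Moments

section Chandrasekhar

open Polynomial

/-- The polynomial `μ ↦ g^m(w, μ)`. -/
noncomputable def gPoly (ϖ : ℝ) (β : ℕ → ℝ) (L m : ℕ) (w : ℝ) : ℝ[X] :=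
  ∑ l ∈ Finset.Icc m L, C (β l * gml ϖ β L m l w) * normAssocLegendre m (l - m)

theorem gfun_eq_eval (ϖ : ℝ) (β : ℕ → ℝ) (L m : ℕ) (w μ : ℝ) :
    gfun ϖ β L m w μ = (gPoly ϖ β L m w).eval μ := by
  rw [gfun, gPoly, eval_finsetSum]
  refine Finset.sum_congr rfl fun l hl => ?_
  obtain ⟨n, rfl⟩ := Nat.exists_eq_add_of_le (Finset.mem_Icc.1 hl).1
  rw [pml_add_eq_eval, Nat.add_sub_cancel_left, eval_mul, eval_C]
  ring

theorem gml_add (ϖ : ℝ) (β : ℕ → ℝ) (L m n : ℕ) (w : ℝ) :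
    gml ϖ β L m (m + n) w = chandraAux ϖ β L m w n := by
  simp [gml]

theorem weightFunctional_gPoly_mul (ϖ : ℝ) (β : ℕ → ℝ) (L m n : ℕ) (w : ℝ) :
    (2 * ((m : ℝ) + n) + 1) * (ϖ * weightFunctional m (gPoly ϖ β L m w * normAssocLegendre m n))
      = 2 * ((2 * ((m : ℝ) + n) + 1 - hcoef ϖ β L (m + n)) * chandraAux ϖ β L m w n) := by
  have h1 : weightFunctional m (gPoly ϖ β L m w * normAssocLegendre m n)
      = ∑ l ∈ Finset.Icc m L, if m + n = l then β l * gml ϖ β L m l w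
        * weightFunctional m (normAssocLegendre m n * normAssocLegendre m n) else 0 := by
    rw [gPoly, Finset.sum_mul, map_sum]
    refine Finset.sum_congr rfl fun l hl => ?_
    obtain ⟨k, rfl⟩ := Nat.exists_eq_add_of_le (Finset.mem_Icc.1 hl).1
    rw [mul_assoc, map_C_mul_poly, Nat.add_sub_cancel_left]
    split_ifs with h
    · rw [Nat.add_left_cancel h]
    · rw [weightFunctional_mul_of_ne m k n (by omega), mul_zero]
  have h2 := weightFunctional_mul_self m n
  rw [h1, Finset.sum_ite_eq, hcoef, gml_add]
  by_cases hL : m + n ≤ L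
  · rw [if_pos (Finset.mem_Icc.2 ⟨Nat.le_add_right m n, hL⟩), if_pos hL]
    push_cast
    linear_combination (ϖ * β (m + n) * chandraAux ϖ β L m w n) * h2
  · rw [if_neg (fun h => hL (Finset.mem_Icc.1 h).2), if_neg hL]
    push_cast
    ring

/-- A functional inverting multiplication by `w - X` against the weighted functional reproduces
the Chandrasekhar polynomials as soon as it is normalized. -/
theorem map_normAssocLegendre_eq_chandraAux (ϖ : ℝ) (β : ℕ → ℝ) (L m : ℕ) (w : ℝ)
    (Λ : ℝ[X] →ₗ[ℝ] ℝ) (h1 : Λ 1 = 1)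
    (hΛ : ∀ f, Λ ((C w - X) * f) = ϖ * w / 2 * weightFunctional m (gPoly ϖ β L m w * f)) (n : ℕ) :
    Λ (normAssocLegendre m n) = chandraAux ϖ β L m w n := by
  have hX : ∀ n, Λ (normAssocLegendre m n) = chandraAux ϖ β L m w n →
      Λ (C (2 * ((m : ℝ) + n) + 1) * X * normAssocLegendre m n)
        = w * hcoef ϖ β L (m + n) * chandraAux ϖ β L m w n := by
    intro n hn
    have h2 := hΛ (normAssocLegendre m n)
    have h3 := weightFunctional_gPoly_mul ϖ β L m n w
    rw [sub_mul, map_sub, map_C_mul_poly, hn] at h2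
    rw [mul_assoc, map_C_mul_poly]
    linear_combination (-(2 * ((m : ℝ) + n) + 1)) * h2 - w / 2 * h3
  induction n using Nat.strong_induction_on with
  | _ n ih =>
    match n, ih with
    | 0, _ =>
      rw [normAssocLegendre_zero, ← mul_one (C _), map_C_mul_poly, h1, mul_one, chandraAux]
    | 1, ih =>
      have h := hX 0 (ih 0 one_pos)
      rw [Nat.cast_zero, add_zero, add_zero, X_mul_normAssocLegendre_zero, map_C_mul_poly] at h
      have hr : √(((m : ℝ) + 1) ^ 2 - (m : ℝ) ^ 2) = recCoef m 1 := by simp [recCoef]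
      rw [chandraAux, hr, eq_div_iff (recCoef_succ_pos m 0).ne', mul_comm, h, chandraAux]
    | n + 2, ih =>
      have h := hX (n + 1) (ih (n + 1) (by omega))
      rw [show 2 * ((m : ℝ) + (n + 1 : ℕ)) + 1 = 2 * ((m : ℝ) + n + 1) + 1 by push_cast; ring,
        X_mul_normAssocLegendre_succ, map_add, map_C_mul_poly, map_C_mul_poly,
        ih n (by omega)] at h
      have hr1 : √(((m + n + 1 : ℕ) : ℝ) ^ 2 - (m : ℝ) ^ 2) = recCoef m (n + 1) := rfl
      have hr2 : √(((m + n + 2 : ℕ) : ℝ) ^ 2 - (m : ℝ) ^ 2) = recCoef m (n + 2) := rfl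
      rw [chandraAux, hr1, hr2, eq_div_iff (recCoef_succ_pos m (n + 1)).ne']
      rw [← Nat.add_assoc] at h
      linear_combination h

end Chandrasekhar


/-- STATEMENT 13 (moments of a discrete singular eigenfunction),
with `φ^m(w,μ) = (ϖ w/2) g^m(w,μ)/(w−μ)`. -/
theorem stmt_13 (L : ℕ) (hL : 1 ≤ L) (ϖ : ℝ) (hϖ : ϖ ∈ Set.Ioo (0 : ℝ) 1)
    (β : ℕ → ℝ) (hβ0 : β 0 = 1)
    (hβ : ∀ l : ℕ, 1 ≤ l → l ≤ L → β l ∈ Set.Ioo (0 : ℝ) (2 * (l : ℝ) + 1))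
    (m : ℕ) (hm : m ≤ L)
    (w : ℝ) (hw : 1 < |w|) (h0 : Lam ϖ β L m w = 0) (l : ℕ) (hl : m ≤ l) :
    ∫ μ in (-1 : ℝ)..1,
        ϖ * w / 2 * gfun ϖ β L m w μ / (w - μ) * pml m l μ * (1 - μ ^ 2) ^ m =
      gml ϖ β L m l w := by
  obtain ⟨n, rfl⟩ := Nat.exists_eq_add_of_le hl
  have hne : ∀ x ∈ Set.uIcc (-1 : ℝ) 1, w - x ≠ 0 := by
    intro x hx h
    rw [Set.uIcc_of_le (by norm_num)] at hx
    exact absurd (abs_le.2 hx) (not_le.2 (by rwa [← sub_eq_zero.1 h]))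
  have hρ : ContinuousOn (fun x => ϖ * w / 2 * (gPoly ϖ β L m w).eval x / (w - x) * (1 - x ^ 2) ^ m)
      (Set.uIcc (-1) 1) :=
    (ContinuousOn.div (by fun_prop) (by fun_prop) hne).mul (by fun_prop)
  rw [gml_add, ← map_normAssocLegendre_eq_chandraAux ϖ β L m w (momentFunctional _ hρ) ?_ ?_ n,
    momentFunctional_apply]
  · refine intervalIntegral.integral_congr fun x _ => ?_
    simp only [gfun_eq_eval, pml_add_eq_eval]
    ring
  · have h : ϖ * w / 2 * ∫ μ in (-1 : ℝ)..1, gfun ϖ β L m w μ / (w - μ) * (1 - μ ^ 2) ^ m = 1 := by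
      rw [Lam] at h0
      linarith
    refine Eq.trans ?_ h
    rw [momentFunctional_apply, ← intervalIntegral.integral_const_mul]
    refine intervalIntegral.integral_congr fun x _ => ?_
    simp only [gfun_eq_eval, Polynomial.eval_one]
    ring
  · intro f
    rw [momentFunctional_apply, weightFunctional_apply, ← intervalIntegral.integral_const_mul]
    refine intervalIntegral.integral_congr fun x hx => ?_
    have := hne x hx
    simp only [Polynomial.eval_mul, Polynomial.eval_sub, Polynomial.eval_C, Polynomial.eval_X]
    field_simp
end

section
/- (Orthogonality of the normalized derivatives of Legendre polynomials.) For all integers l, l' ≥ m, ∫_{−1}^{1} p_l^m(μ) p_{l'}^m(μ) (1−μ²)^m dμ = (2/(2l+1)) δ_{l l'}, where δ_{l l'} is the Kronecker delta. -/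
open MeasureTheory Filter

open Polynomial in
theorem iteratedDeriv_polynomial_eval (p : ℝ[X]) (n : ℕ) :
    iteratedDeriv n (fun x => p.eval x) = fun x => (derivative^[n] p).eval x := by
  induction n with
  | zero => simp
  | succ n ih =>
    rw [iteratedDeriv_succ, ih, Function.iterate_succ_apply']
    ext x
    exact Polynomial.deriv _

open Polynomial in
/-- Repeated integration by parts when all boundary terms vanish. -/
theorem integral_iterate_derivative_mul (a b : ℝ) (p : ℝ[X]) (n : ℕ) (q : ℝ[X])
    (ha : ∀ i j, i + j + 1 = n → (derivative^[i] p * derivative^[j] q).eval a = 0)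
    (hb : ∀ i j, i + j + 1 = n → (derivative^[i] p * derivative^[j] q).eval b = 0) :
    ∫ x in a..b, (derivative^[n] p).eval x * q.eval x =
      (-1) ^ n * ∫ x in a..b, p.eval x * (derivative^[n] q).eval x := by
  induction n generalizing q with
  | zero => simp
  | succ n ih =>
    have hparts := intervalIntegral.integral_deriv_mul_eq_sub
      (a := a) (b := b) (u := fun x => (derivative^[n] p).eval x) (v := fun x => q.eval x)
      (fun x _ => (derivative^[n] p).hasDerivAt x) (fun x _ => q.hasDerivAt x)
      ((Polynomial.continuous _).intervalIntegrable _ _)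
      ((Polynomial.continuous _).intervalIntegrable _ _)
    have ha0 := ha n 0 rfl
    have hb0 := hb n 0 rfl
    simp only [eval_mul, Function.iterate_zero, id] at ha0 hb0
    rw [ha0, hb0, sub_zero, intervalIntegral.integral_add
      (Continuous.intervalIntegrable (by fun_prop) _ _)
      (Continuous.intervalIntegrable (by fun_prop) _ _)] at hparts
    have hstep := ih (derivative q) (fun i j h => ha i (j + 1) (by lia))
      (fun i j h => hb i (j + 1) (by lia))
    rw [hstep] at hparts
    rw [Function.iterate_succ_apply', Function.iterate_succ_apply, pow_succ]
    linarith

open Polynomial in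
theorem eval_iterate_derivative_mul_eq_zero {a : ℝ} {p q : ℝ[X]} {r s i j : ℕ}
    (hp : (X - C a) ^ r ∣ p) (hq : (X - C a) ^ s ∣ q) (h : i + j < r + s) :
    (derivative^[i] p * derivative^[j] q).eval a = 0 := by
  have key : ∀ {f : ℝ[X]} {t k : ℕ}, (X - C a) ^ t ∣ f → k < t →
      (derivative^[k] f).eval a = 0 := fun hf hk =>
    dvd_iff_isRoot.mp ((dvd_pow_self _ (Nat.sub_ne_zero_of_lt hk)).trans
      (pow_sub_dvd_iterate_derivative_of_pow_dvd _ hf))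
  rw [eval_mul]
  rcases lt_or_ge i r with hi | hi
  · rw [key hp hi, zero_mul]
  · rw [key hq (by lia), mul_zero]

open Polynomial in
theorem iterate_derivative_of_natDegree_le {p : ℝ[X]} {n : ℕ} (h : p.natDegree ≤ n) :
    derivative^[n] p = C ((n.factorial : ℝ) * p.coeff n) := by
  have hd : (derivative^[n] p).natDegree = 0 := by
    have := natDegree_iterate_derivative p n
    lia
  rw [eq_C_of_natDegree_eq_zero hd, coeff_iterate_derivative]
  simp [Nat.descFactorial_self]

open Polynomial in
theorem integral_sq_sub_one_pow (l : ℕ) :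
    ∫ x in (-1 : ℝ)..1, (x ^ 2 - 1) ^ l =
      (-1) ^ l * ((l.factorial : ℝ) ^ 2 * 2 ^ (2 * l + 1) / (2 * l + 1).factorial) := by
  have hparts := integral_iterate_derivative_mul (-1) 1 ((X + C 1) ^ (2 * l)) l ((X - C 1) ^ l)
    (fun i j h => eval_iterate_derivative_mul_eq_zero (r := 2 * l) (s := 0)
      (by simp) (by simp) (by lia))
    (fun i j h => eval_iterate_derivative_mul_eq_zero (r := 0) (s := l)
      (by simp) (by simp) (by lia))
  have hint : ∫ x in (-1 : ℝ)..1, (x + 1) ^ (2 * l) = 2 ^ (2 * l + 1) / (2 * l + 1) := by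
    rw [intervalIntegral.integral_comp_add_right (fun x => x ^ (2 * l)), integral_pow]
    norm_num
  have hdesc : (l.factorial : ℝ) * ((2 * l).descFactorial l : ℝ) = (2 * l).factorial := by
    have := Nat.factorial_mul_descFactorial (n := 2 * l) (k := l) (by lia)
    rw [show 2 * l - l = l by lia] at this
    exact_mod_cast this
  have hleft : ∀ x : ℝ, (derivative^[l] ((X + C 1 : ℝ[X]) ^ (2 * l))).eval x *
      ((X - C 1 : ℝ[X]) ^ l).eval x = (2 * l).descFactorial l * (x ^ 2 - 1) ^ l := fun x => by
    rw [iterate_derivative_X_add_pow, show 2 * l - l = l by lia,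
      show x ^ 2 - 1 = (x + 1) * (x - 1) by ring, mul_pow]
    simp [mul_assoc]
  have hright : derivative^[l] ((X - C 1 : ℝ[X]) ^ l) = C (l.factorial : ℝ) := by
    rw [iterate_derivative_X_sub_pow_self]
    simp
  simp only [hleft, hright] at hparts
  simp only [eval_pow, eval_add, eval_X, eval_C] at hparts
  rw [intervalIntegral.integral_const_mul, intervalIntegral.integral_mul_const, hint] at hparts
  have hl : (l.factorial : ℝ) ≠ 0 := by positivity
  have hd : ((2 * l).descFactorial l : ℝ) ≠ 0 := by
    intro h
    rw [h, mul_zero] at hdesc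
    exact (by positivity : ((2 * l).factorial : ℝ) ≠ 0) hdesc.symm
  apply mul_left_cancel₀ hd
  rw [hparts, Nat.factorial_succ, Nat.cast_mul, ← hdesc]
  push_cast
  field_simp

open Polynomial in
theorem pml_eq_eval (m l : ℕ) (x : ℝ) :
    pml m l x = Real.sqrt ((l - m).factorial / (l + m).factorial) *
      (1 / (2 ^ l * l.factorial)) * (derivative^[l + m] ((X ^ 2 - 1 : ℝ[X]) ^ l)).eval x := by
  have hP : legendreP l = fun x =>
      (C (1 / (2 ^ l * l.factorial : ℝ)) * derivative^[l] ((X ^ 2 - 1) ^ l)).eval x := by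
    ext x
    have := iteratedDeriv_polynomial_eval ((X ^ 2 - 1 : ℝ[X]) ^ l) l
    simp only [eval_pow, eval_sub, eval_X, eval_one] at this
    rw [legendreP, this, eval_mul, eval_C]
  rw [pml, hP, iteratedDeriv_polynomial_eval]
  beta_reduce
  rw [iterate_derivative_C_mul, eval_mul, eval_C, ← Function.iterate_add_apply, add_comm m l, mul_assoc]

open Polynomial in
theorem coeff_one_sub_sq_pow_mul_iterate_derivative {m l : ℕ} (h : m ≤ l) :
    ((1 - X ^ 2 : ℝ[X]) ^ m * derivative^[l + m] ((X ^ 2 - 1) ^ l)).coeff (l + m) =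
      (-1) ^ m * (((2 * l).factorial : ℝ) / (l - m).factorial) := by
  have hdeg : (derivative^[l + m] ((X ^ 2 - 1 : ℝ[X]) ^ l)).natDegree ≤ l - m := by
    have h1 := natDegree_iterate_derivative ((X ^ 2 - 1 : ℝ[X]) ^ l) (l + m)
    have h2 : ((X ^ 2 - 1 : ℝ[X]) ^ l).natDegree ≤ l * 2 :=
      natDegree_pow_le_of_le l (by compute_degree)
    lia
  have hdeg' : ((1 - X ^ 2 : ℝ[X]) ^ m).natDegree ≤ m * 2 :=
    natDegree_pow_le_of_le m (by compute_degree)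
  rw [show l + m = m * 2 + (l - m) by lia] at hdeg ⊢
  rw [coeff_mul_add_eq_of_natDegree_le hdeg' hdeg,
    coeff_pow_of_natDegree_le (by compute_degree), coeff_iterate_derivative,
    show l - m + (m * 2 + (l - m)) = l * 2 by lia,
    coeff_pow_of_natDegree_le (by compute_degree)]
  have hdesc : ((l - m).factorial : ℝ) * ((l * 2).descFactorial (m * 2 + (l - m)) : ℝ) =
      (2 * l).factorial := by
    have := Nat.factorial_mul_descFactorial (n := l * 2) (k := m * 2 + (l - m)) (by lia)
    rw [show l * 2 - (m * 2 + (l - m)) = l - m by lia, mul_comm l 2] at this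
    rw [mul_comm l 2]
    exact_mod_cast this
  rw [← hdesc]
  have hne : ((l - m).factorial : ℝ) ≠ 0 := by positivity
  simp [coeff_one, coeff_X_pow]
  field_simp

open Polynomial in
theorem integral_iterate_derivative_sq_sub_one_pow {m l l' : ℕ} (h : m ≤ l') (hle : l' ≤ l) :
    ∫ x in (-1 : ℝ)..1, (derivative^[l + m] ((X ^ 2 - 1 : ℝ[X]) ^ l)).eval x *
        ((1 - X ^ 2 : ℝ[X]) ^ m * derivative^[l' + m] ((X ^ 2 - 1) ^ l')).eval x =
      (if l = l' then ((l + m).factorial : ℝ) / (l - m).factorial *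
        ((l.factorial : ℝ) ^ 2 * 2 ^ (2 * l + 1) / (2 * l + 1)) else 0) := by
  set q : ℝ[X] := (1 - X ^ 2) ^ m * derivative^[l' + m] ((X ^ 2 - 1) ^ l') with hq
  have hdeg : q.natDegree ≤ l' + m := by
    have h1 := natDegree_iterate_derivative ((X ^ 2 - 1 : ℝ[X]) ^ l') (l' + m)
    have h2 : ((X ^ 2 - 1 : ℝ[X]) ^ l').natDegree ≤ l' * 2 :=
      natDegree_pow_le_of_le l' (by compute_degree)
    have h3 : ((1 - X ^ 2 : ℝ[X]) ^ m).natDegree ≤ m * 2 :=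
      natDegree_pow_le_of_le m (by compute_degree)
    have h4 := natDegree_mul_le (p := (1 - X ^ 2 : ℝ[X]) ^ m)
      (q := derivative^[l' + m] ((X ^ 2 - 1) ^ l'))
    lia
  have hvanish : ∀ a : ℝ, X - C a ∣ X ^ 2 - 1 → X - C a ∣ 1 - X ^ 2 →
      ∀ i j, i + j + 1 = l + m →
        (derivative^[i] ((X ^ 2 - 1 : ℝ[X]) ^ l) * derivative^[j] q).eval a = 0 :=
    fun a h1 h2 i j hij => eval_iterate_derivative_mul_eq_zero (r := l) (s := m)
      (pow_dvd_pow_of_dvd h1 l) ((pow_dvd_pow_of_dvd h2 m).mul_right _) (by lia)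
  rw [integral_iterate_derivative_mul (-1) 1 _ _ q
    (hvanish _ (dvd_iff_isRoot.mpr (by simp)) (dvd_iff_isRoot.mpr (by simp)))
    (hvanish _ (dvd_iff_isRoot.mpr (by simp)) (dvd_iff_isRoot.mpr (by simp))),
    iterate_derivative_of_natDegree_le (hdeg.trans (by lia))]
  simp only [eval_C, eval_pow, eval_sub, eval_X, eval_one]
  rw [intervalIntegral.integral_mul_const, integral_sq_sub_one_pow]
  split_ifs with heq
  · subst heq
    rw [hq, coeff_one_sub_sq_pow_mul_iterate_derivative h, Nat.factorial_succ (2 * l)]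
    have h1 : ((2 * l).factorial : ℝ) ≠ 0 := by positivity
    have h2 : ((l - m).factorial : ℝ) ≠ 0 := by positivity
    have hsign : (-1 : ℝ) ^ (l + m) * (-1) ^ l * (-1) ^ m = 1 := by
      rw [mul_assoc, ← pow_add, ← mul_pow]
      simp
    push_cast
    field_simp
    exact hsign
  · rw [coeff_eq_zero_of_natDegree_lt (by lia)]
    simp

open Polynomial in
theorem integral_pml_mul_pml_of_le {m l l' : ℕ} (h : m ≤ l') (hle : l' ≤ l) :
    ∫ μ in (-1 : ℝ)..1, pml m l μ * pml m l' μ * (1 - μ ^ 2) ^ m =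
      if l = l' then 2 / (2 * (l : ℝ) + 1) else 0 := by
  have hint := integral_iterate_derivative_sq_sub_one_pow h hle
  have hform : ∀ x : ℝ, pml m l x * pml m l' x * (1 - x ^ 2) ^ m =
      (Real.sqrt ((l - m).factorial / (l + m).factorial) * (1 / (2 ^ l * l.factorial)) *
        (Real.sqrt ((l' - m).factorial / (l' + m).factorial) * (1 / (2 ^ l' * l'.factorial)))) *
      ((derivative^[l + m] ((X ^ 2 - 1 : ℝ[X]) ^ l)).eval x *
        ((1 - X ^ 2 : ℝ[X]) ^ m * derivative^[l' + m] ((X ^ 2 - 1) ^ l')).eval x) := fun x => by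
    rw [pml_eq_eval, pml_eq_eval, eval_mul]
    simp only [eval_pow, eval_sub, eval_X, eval_one]
    ring
  simp only [hform]
  rw [intervalIntegral.integral_const_mul, hint]
  split_ifs with heq
  · subst heq
    have hsqrt := Real.mul_self_sqrt
      (by positivity : (0 : ℝ) ≤ (l - m).factorial / (l + m).factorial)
    have h1 : ((l - m).factorial : ℝ) ≠ 0 := by positivity
    rw [mul_mul_mul_comm (√_), hsqrt]
    field_simp
    ring
  · simp

/-- orthogonality of the normalized derivatives of Legendre
polynomials. -/
theorem stmt_15 (m : ℕ) (l l' : ℕ) (hl : m ≤ l) (hl' : m ≤ l') :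
    ∫ μ in (-1 : ℝ)..1, pml m l μ * pml m l' μ * (1 - μ ^ 2) ^ m =
      if l = l' then 2 / (2 * (l : ℝ) + 1) else 0 := by
  rcases le_total l' l with h | h
  · exact integral_pml_mul_pml_of_le hl' h
  · refine (intervalIntegral.integral_congr fun x _ => ?_).trans
      ((integral_pml_mul_pml_of_le hl h).trans ?_)
    · ring
    · rcases eq_or_ne l l' with rfl | hne
      · rfl
      · rw [if_neg hne, if_neg hne.symm]
end
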